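/- Let G be an amenable group with a Følner net F. Let X be an irreducible complete algebraic variety over an algebraically closed field K and let A := X(K). Let τ : A^G → A^G be an algebraic cellular automaton over (G,X,K). If mdim_F(τ(A^G)) = dim(X), then τ is surjective. -/

import Mathlib

open AlgebraicGeometry CategoryTheory CategoryTheory.Limits Filter Topology
open scoped ENNReal NNReal

noncomputable section

namespace GOE

/-! ## Følner nets and amenability -/

/-- A (right) Følner net for a group `G`: a net of nonempty finite subsets `F i ⊆ G`,
indexed by a directed nonempty preorder, such that `|F i \ F i g| / |F i| → 0` for every
`g ∈ G`. -/
structure FolnerNet (G : Type) [Group G] where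
  ι : Type
  [pre : Preorder ι]
  [ne : Nonempty ι]
  [dir : IsDirected ι (· ≤ ·)]
  F : ι → Finset G
  nonempty : ∀ i, (F i).Nonempty
  folner : ∀ g : G,
    Filter.Tendsto
      (fun i => ((((F i : Set G) \ ((· * g) '' (F i : Set G))).ncard : ℝ) / ((F i).card : ℝ)))
      Filter.atTop (nhds 0)

attribute [instance] FolnerNet.pre FolnerNet.ne FolnerNet.dir

/-- A group is amenable if it admits a Følner net. -/
def Amenable (G : Type) [Group G] : Prop := Nonempty (FolnerNet G)

/-! ## Constructible subsets of a topological space -/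

/-- A subset of a topological space is constructible if it is a finite union of
locally closed subsets. -/
def IsConstr {X : Type} [TopologicalSpace X] (C : Set X) : Prop :=
  ∃ (n : ℕ) (U Z : Fin n → Set X), (∀ i, IsOpen (U i)) ∧ (∀ i, IsClosed (Z i)) ∧
    C = ⋃ i, U i ∩ Z i

/-- Conversion of a Krull dimension (an element of `WithBot ℕ∞`) to an extended real. -/
def dimE (d : WithBot ℕ∞) : EReal :=
  WithBot.recBotCoe ⊥ (fun n : ℕ∞ => ((n : ℝ≥0∞) : EReal)) d

/-! ## Varieties over a field and their points -/

variable (K : Type) [Field K]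

/-- The spectrum of the field `K`, as a scheme. -/
abbrev SpecK : Scheme := Spec (CommRingCat.of K)

/-- The unique point of `Spec K`. -/
def specPt : SpecK K := (⟨⊥, Ideal.bot_prime⟩ : PrimeSpectrum K)

instance : HasFiniteProducts (Over (SpecK K)) :=
  CategoryTheory.Over.ConstructProducts.over_finiteProducts_of_finiteWidePullbacks

/-- The set of `K`-points of a `K`-scheme, i.e. sections of the structure morphism,
i.e. morphisms `Spec K ⟶ X` over `Spec K`. -/
abbrev Pt (W : Over (SpecK K)) : Type := Over.mk (𝟙 (SpecK K)) ⟶ W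

/-- The image in (the underlying space of) `W` of a `K`-point of `W`. -/
def ev {W : Over (SpecK K)} (a : Pt K W) : W.left := a.left.base (specPt K)

/-- The fibered power `X^Ω` over `Spec K` of a `K`-scheme `X`, for a finite index set `Ω`. -/
def pow (V : Over (SpecK K)) (Ω : Type) [Finite Ω] : Over (SpecK K) :=
  ∏ᶜ (fun _ : Ω => V)

/-- The canonical identification of families of `K`-points indexed by `Ω` with
`K`-points of the fibered power `X^Ω`. -/
def ptPow (V : Over (SpecK K)) (Ω : Type) [Finite Ω] (a : Ω → Pt K V) :
    Pt K (pow K V Ω) := Pi.lift a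

variable (V : Over (SpecK K))

/-- The Krull dimension of (the underlying space of) a `K`-scheme. -/
def vdim : WithBot ℕ∞ := topologicalKrullDim V.left

/-- The Zariski topology on `A^Ω` (`A` the set of `K`-points of `X`), induced from the
Zariski topology of the fibered power `X^Ω` via the identification of `A^Ω` with a
subset (the set of closed points, for `K` algebraically closed) of `X^Ω`. -/
def cfgTop (Ω : Type) [Finite Ω] : TopologicalSpace (Ω → Pt K V) :=
  TopologicalSpace.induced (fun u => ev K (ptPow K V Ω u)) inferInstance

/-- The Krull dimension of a subset `D ⊆ A^Ω` for the Zariski topology. -/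
def cfgDim (Ω : Type) [Finite Ω] (D : Set (Ω → Pt K V)) : WithBot ℕ∞ :=
  letI := cfgTop K V Ω
  topologicalKrullDim D

/-- `D ⊆ A^Ω` is closed for the Zariski topology. -/
def cfgClosed (Ω : Type) [Finite Ω] (D : Set (Ω → Pt K V)) : Prop :=
  letI := cfgTop K V Ω
  IsClosed D

/-- `D ⊆ A^Ω` is constructible for the Zariski topology. -/
def cfgConstr (Ω : Type) [Finite Ω] (D : Set (Ω → Pt K V)) : Prop :=
  letI := cfgTop K V Ω
  IsConstr D

/-! ## Configurations, restrictions, cylinders -/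

variable {G : Type} [Group G]

/-- The restriction `Γ_Ω ⊆ A^Ω` of a set of configurations `Γ ⊆ A^G`. -/
def restr (Γ : Set (G → Pt K V)) (Ω : Finset G) : Set (↥Ω → Pt K V) :=
  (fun c (ω : ↥Ω) => c ω) '' Γ

/-- The cylinder `D_p ⊆ A^G`: configurations restricting to an element of `D` on `Ω` and
to `p` on `G ∖ Ω`. -/
def cyl (Ω : Finset G) (D : Set (↥Ω → Pt K V)) (p : {g : G // g ∉ Ω} → Pt K V) :
    Set (G → Pt K V) :=
  {c | (fun ω : ↥Ω => c ω) ∈ D ∧ ∀ (g : G) (h : g ∉ Ω), c g = p ⟨g, h⟩}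

/-- Algebraic mean dimension of `Γ ⊆ A^G` with respect to a Følner net. -/
def mdim (𝓕 : FolnerNet G) (Γ : Set (G → Pt K V)) : EReal :=
  Filter.limsup
    (fun i => dimE (cfgDim K V ↥(𝓕.F i) (restr K V Γ (𝓕.F i))) *
      ((((𝓕.F i).card : ℝ)⁻¹ : ℝ) : EReal))
    Filter.atTop

/-! ## Cellular automata -/

/-- `τ : A^G → A^G` is an algebraic cellular automaton over `(G, X, K)`: it admits a finite
memory set `M ⊆ G` whose associated local defining map `A^M → A` is induced by a morphism
of `K`-schemes `f : X^M → X`. -/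
def IsAlgCA (τ : (G → Pt K V) → (G → Pt K V)) : Prop :=
  ∃ (M : Finset G) (f : pow K V ↥M ⟶ V),
    ∀ (x : G → Pt K V) (g : G),
      τ x g = ptPow K V ↥M (fun m => x (g * (m : G))) ≫ f

/-- Pre-injectivity: configurations that are almost equal and have the same image are equal. -/
def PreInjective (τ : (G → Pt K V) → (G → Pt K V)) : Prop :=
  ∀ c₁ c₂ : G → Pt K V, {g : G | c₁ g ≠ c₂ g}.Finite → τ c₁ = τ c₂ → c₁ = c₂

/-- `(*)`-pre-injectivity: there exist no finite subset `Ω ⊆ G` and Zariski-closed proper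
subset `H ⊊ A^Ω` such that `τ((A^Ω)_p) = τ(H_p)` for all `p ∈ A^{G∖Ω}`. -/
def StarPreInjective (τ : (G → Pt K V) → (G → Pt K V)) : Prop :=
  ¬ ∃ (Ω : Finset G) (H : Set (↥Ω → Pt K V)), cfgClosed K V ↥Ω H ∧ H ≠ Set.univ ∧
      ∀ p : {g : G // g ∉ Ω} → Pt K V,
        τ '' cyl K V Ω Set.univ p = τ '' cyl K V Ω H p

/-- `(**)`-pre-injectivity: there is no finite subset `Ω ⊆ G` such that, for every
`p ∈ A^{G∖Ω}`, the finite-support set `τ((A^Ω)_p)` (written as some `R_s`) satisfies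
`dim(R) < dim(A^Ω)`. -/
def StarStarPreInjective (τ : (G → Pt K V) → (G → Pt K V)) : Prop :=
  ¬ ∃ Ω : Finset G, ∀ p : {g : G // g ∉ Ω} → Pt K V,
      ∃ (Λ : Finset G) (R : Set (↥Λ → Pt K V)) (s : {g : G // g ∉ Λ} → Pt K V),
        τ '' cyl K V Ω Set.univ p = cyl K V Λ R s ∧
        cfgDim K V ↥Λ R < cfgDim K V ↥Ω (Set.univ : Set (↥Ω → Pt K V))

/-- `Γ ⊆ A^G` is closed for the prodiscrete topology on `A^G`. -/
def ProdiscreteClosed {A : Type} (Γ : Set (G → A)) : Prop :=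
  letI : TopologicalSpace A := ⊥
  IsClosed Γ

/-- `Γ ⊆ A^G` is invariant under the shift action of `G`. -/
def ShiftInvariant {A : Type} (Γ : Set (G → A)) : Prop :=
  ∀ (g : G), ∀ c ∈ Γ, (fun h : G => c (g⁻¹ * h)) ∈ Γ

/-- An `(E,E')`-tiling of `G`. -/
def IsTiling (E E' : Finset G) (T : Set G) : Prop :=
  (∀ g ∈ T, ∀ h ∈ T, g ≠ h →
    Disjoint ((g * ·) '' (E : Set G)) ((h * ·) '' (E : Set G))) ∧
  ∀ x : G, ∃ g ∈ T, x ∈ (g * ·) '' (E' : Set G)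


theorem ringKrullDim_eq_of_isIntegral_of_injective {R S : Type*} [CommRing R] [CommRing S]
    [Algebra R S] [Algebra.IsIntegral R S] (hinj : Function.Injective (algebraMap R S)) :
    ringKrullDim S = ringKrullDim R := by
  apply le_antisymm
  · refine Order.krullDim_le_of_strictMono (fun p => p.comap (algebraMap R S)) ?_
    intro p q hpq
    exact Ideal.IsIntegral.comap_lt_comap (R := R) (I := p.asIdeal) (J := q.asIdeal) hpq
  · refine iSup_le fun c => ?_
    suffices h : ∃ d : LTSeries (PrimeSpectrum S), d.length = c.length ∧
        d.last.comap (algebraMap R S) = c.last by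
      obtain ⟨d, hd, -⟩ := h
      rw [← hd]
      exact Order.LTSeries.length_le_krullDim d
    induction c using RelSeries.inductionOn' with
    | singleton x =>
      obtain ⟨Q, -, hQ, hQx⟩ := Ideal.exists_ideal_over_prime_of_isIntegral (S := S) x.asIdeal ⊥
        (by rw [← RingHom.ker_eq_comap_bot, (RingHom.injective_iff_ker_eq_bot _).1 hinj]; simp)
      exact ⟨RelSeries.singleton _ ⟨Q, hQ⟩, rfl, PrimeSpectrum.ext hQx⟩
    | snoc p x hx ih =>
      obtain ⟨d, hd, hdl⟩ := ih
      have hlt : p.last < x := hx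
      obtain ⟨Q, hQd, hQ, hQx⟩ := Ideal.exists_ideal_over_prime_of_isIntegral (S := S) x.asIdeal
        d.last.asIdeal (by
          have : (d.last.comap (algebraMap R S)).asIdeal = p.last.asIdeal := by rw [hdl]
          rw [PrimeSpectrum.comap_asIdeal] at this
          rw [this]; exact hlt.le)
      have hQlt : d.last < ⟨Q, hQ⟩ := by
        refine lt_of_le_of_ne hQd ?_
        rintro h
        apply hlt.ne
        rw [← hdl]
        apply PrimeSpectrum.ext
        rw [h]; exact hQx
      exact ⟨d.snoc ⟨Q, hQ⟩ hQlt, by simp [hd], by simpa using PrimeSpectrum.ext hQx⟩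

theorem ringKrullDim_eq_trdeg {K A : Type} [Field K] [CommRing A] [IsDomain A] [Algebra K A]
    [Algebra.FiniteType K A] : ringKrullDim A = (Cardinal.toNat (Algebra.trdeg K A) : ℕ) := by
  obtain ⟨s, g, hg, hgi⟩ := exists_integral_inj_algHom_of_fg K A
  algebraize [g.toRingHom]
  have h1 := ringKrullDim_eq_of_isIntegral_of_injective (R := MvPolynomial (Fin s) K) (S := A) hg
  have : FaithfulSMul (MvPolynomial (Fin s) K) A := (faithfulSMul_iff_algebraMap_injective _ _).2 hg
  have h2 := trdeg_add_eq K (MvPolynomial (Fin s) K) (A := A)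
  rw [trdeg_eq_zero (R := MvPolynomial (Fin s) K), add_zero] at h2
  rw [h1, ← h2, MvPolynomial.trdeg_of_isDomain, MvPolynomial.ringKrullDim_of_isNoetherianRing]
  simp

theorem trdeg_eq_trdeg_of_fraction {K A L : Type} [Field K] [CommRing A] [IsDomain A] [Algebra K A]
    [Field L] [Algebra K L] [Algebra A L] [IsScalarTower K A L]
    (hinj : Function.Injective (algebraMap A L))
    (hfrac : ∀ s : L, ∃ x r : A, algebraMap A L r ≠ 0 ∧ algebraMap A L r * s = algebraMap A L x) :
    Algebra.trdeg K A = Algebra.trdeg K L := by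
  have : FaithfulSMul A L := (faithfulSMul_iff_algebraMap_injective _ _).2 hinj
  have : IsFractionRing A L := by
    refine IsFractionRing.of_field A L fun z => ?_
    obtain ⟨x, r, hr, h⟩ := hfrac z
    exact ⟨x, r, by field_simp; rw [mul_comm, h]⟩
  have halg : Algebra.IsAlgebraic A L := IsLocalization.isAlgebraic L (nonZeroDivisors A)
  have h2 := trdeg_add_eq K A (A := L)
  rw [trdeg_eq_zero (R := A), add_zero] at h2
  exact h2

theorem ringKrullDim_quotient_ker_eq_trdeg {K A L : Type} [Field K] [CommRing A] [Algebra K A]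
    [Algebra.FiniteType K A] [Field L] [Algebra K L] (φ : A →ₐ[K] L)
    (hfrac : ∀ s : L, ∃ x r : A, φ r ≠ 0 ∧ φ r * s = φ x) :
    Algebra.trdeg K L < Cardinal.aleph0 ∧
      ringKrullDim (A ⧸ RingHom.ker φ) = (Cardinal.toNat (Algebra.trdeg K L) : ℕ) := by
  have : (RingHom.ker φ).IsPrime := RingHom.ker_isPrime _
  let ψ := Ideal.kerLiftAlg φ
  algebraize [ψ.toRingHom]
  have hψ : ∀ a, algebraMap (A ⧸ RingHom.ker φ) L (Ideal.Quotient.mk _ a) = φ a := fun a => rfl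
  have h : Algebra.trdeg K (A ⧸ RingHom.ker φ) = Algebra.trdeg K L := by
    refine trdeg_eq_trdeg_of_fraction (Ideal.kerLiftAlg_injective φ) fun s => ?_
    obtain ⟨x, r, hr, h⟩ := hfrac s
    exact ⟨Ideal.Quotient.mk _ x, Ideal.Quotient.mk _ r, by rwa [hψ], by rwa [hψ, hψ]⟩
  rw [ringKrullDim_eq_trdeg (K := K), ← h]
  exact ⟨trdeg_lt_aleph0_of_finiteType, rfl⟩

theorem ringKrullDim_quotient_succ_le_of_lt {A : Type} [CommRing A] {p q : Ideal A} [p.IsPrime]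
    (h : p < q) : ringKrullDim (A ⧸ q) + 1 ≤ ringKrullDim (A ⧸ p) := by
  obtain ⟨x, hxq, hxp⟩ := SetLike.exists_of_lt h
  refine ringKrullDim_succ_le_of_surjective (Ideal.Quotient.factor h.le)
    (Ideal.Quotient.factor_surjective h.le) (r := Ideal.Quotient.mk p x) ?_ ?_
  · rw [mem_nonZeroDivisors_iff_ne_zero, ne_eq, Ideal.Quotient.eq_zero_iff_mem]; exact hxp
  · simpa [Ideal.Quotient.eq_zero_iff_mem] using hxq

/-- The residue field at a point of a `K`-scheme, as a `K`-algebra. -/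
instance algebraResidueField {K : Type} [Field K] (W : Over (SpecK K)) (w : W.left) :
    Algebra K (W.left.residueField w) :=
  (Spec.preimage (W.left.fromSpecResidueField w ≫ W.hom)).hom.toAlgebra

theorem specMap_algebraMap_residueField {K : Type} [Field K] (W : Over (SpecK K)) (w : W.left) :
    Spec.map (CommRingCat.ofHom (algebraMap K (W.left.residueField w))) =
      W.left.fromSpecResidueField w ≫ W.hom :=
  Spec.map_preimage _

/-- The transcendence degree of the residue field at a point of a `K`-scheme. -/
def tdeg {K : Type} [Field K] (W : Over (SpecK K)) (w : W.left) : ℕ :=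
  Cardinal.toNat (Algebra.trdeg K (W.left.residueField w))

theorem ringKrullDim_quotient_eq_tdeg {K : Type} [Field K] (W : Over (SpecK K))
    [LocallyOfFiniteType W.hom] {A : CommRingCat.{0}} (j : Spec A ⟶ W.left) [IsOpenImmersion j]
    (x : Spec A) :
    Algebra.trdeg K (W.left.residueField (j x)) < Cardinal.aleph0 ∧
      ringKrullDim (A ⧸ x.asIdeal) = (tdeg W (j x) : ℕ) := by
  let L := W.left.residueField (j x)
  have hrange : Set.range (W.left.fromSpecResidueField (j x)) ⊆ Set.range j := by
    rw [Scheme.range_fromSpecResidueField]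
    rintro _ rfl
    exact ⟨x, rfl⟩
  let l := IsOpenImmersion.lift j (W.left.fromSpecResidueField (j x)) hrange
  have hl : l ≫ j = W.left.fromSpecResidueField (j x) := IsOpenImmersion.lift_fac _ _ _
  obtain ⟨ψ, hψ⟩ : ∃ ψ : A ⟶ L, Spec.map ψ = l := ⟨Spec.preimage l, Spec.map_preimage _⟩
  have hpre : IsPreimmersion (Spec.map ψ) := by
    have : IsPreimmersion (Spec.map ψ ≫ j) := by rw [hψ, hl]; infer_instance
    exact IsPreimmersion.of_comp _ j
  obtain ⟨k, hk⟩ : ∃ k : CommRingCat.of K ⟶ A, Spec.map k = j ≫ W.hom :=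
    ⟨Spec.preimage _, Spec.map_preimage _⟩
  have hkf : k.hom.FiniteType := by
    rw [← HasRingHomProperty.Spec_iff (P := @LocallyOfFiniteType), hk]
    infer_instance
  have hkψ : k ≫ ψ = CommRingCat.ofHom (algebraMap K L) := by
    apply Spec.map_injective
    rw [specMap_algebraMap_residueField, Spec.map_comp, hk, hψ, ← Category.assoc, hl]
  let : Algebra K A := k.hom.toAlgebra
  have : Algebra.FiniteType K A := hkf
  let φ : A →ₐ[K] L := { ψ.hom with
    commutes' := fun r => congrArg (fun g => g.hom r) hkψ }
  have hker : RingHom.ker φ = x.asIdeal := by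
    let s : Spec L := IsLocalRing.closedPoint L
    have h1 : Spec.map ψ s = x := by
      apply j.injective
      refine (Scheme.Hom.comp_apply (Spec.map ψ) j s).symm.trans ?_
      rw [hψ, hl]
      exact Scheme.fromSpecResidueField_apply _ _
    have h2 : x.asIdeal = (Spec.map ψ s).asIdeal := congrArg PrimeSpectrum.asIdeal h1.symm
    refine Eq.trans ?_ h2.symm
    ext a
    change ψ.hom a = 0 ↔ ψ.hom a ∈ IsLocalRing.maximalIdeal L
    simp [IsLocalRing.maximalIdeal_eq_bot]
  rw [← hker]
  refine ringKrullDim_quotient_ker_eq_trdeg φ fun s => ?_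
  have h2 := ((IsPreimmersion.SpecMap_iff ψ).1 hpre).2
  rw [RingHom.surjectiveOnStalks_iff_forall_maximal'] at h2
  obtain ⟨a, r, c, hc, hr, h⟩ := h2 ⊥ Ideal.bot_isMaximal s
  refine ⟨a, r, hr, ?_⟩
  have hc : c ≠ 0 := hc
  rw [mul_assoc] at h
  exact mul_left_cancel₀ hc h

theorem trdeg_residueField_lt_aleph0 {K : Type} [Field K] (W : Over (SpecK K))
    [LocallyOfFiniteType W.hom] (w : W.left) :
    Algebra.trdeg K (W.left.residueField w) < Cardinal.aleph0 := by
  obtain ⟨A, j, _, ⟨x, rfl⟩, -⟩ :=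
    Scheme.exists_affine_mem_range_and_range_subset (x := w) (U := ⊤) trivial
  exact (ringKrullDim_quotient_eq_tdeg W j x).1

theorem tdeg_succ_le_of_specializes {K : Type} [Field K] (W : Over (SpecK K))
    [LocallyOfFiniteType W.hom] {w w' : W.left} (h : w ⤳ w') (hne : w ≠ w') :
    tdeg W w' + 1 ≤ tdeg W w := by
  obtain ⟨A, j, _, ⟨x', rfl⟩, -⟩ :=
    Scheme.exists_affine_mem_range_and_range_subset (x := w') (U := ⊤) trivial
  obtain ⟨x, rfl⟩ : w ∈ Set.range j := h.mem_open j.isOpenEmbedding.isOpen_range ⟨x', rfl⟩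
  have hx : x ⤳ x' := j.isOpenEmbedding.isInducing.specializes_iff.1 h
  have hlt : x.asIdeal < x'.asIdeal := by
    refine lt_of_le_of_ne ((PrimeSpectrum.le_iff_specializes x x').2 hx) fun h => hne ?_
    rw [PrimeSpectrum.ext h]
  have := x.isPrime
  have := ringKrullDim_quotient_succ_le_of_lt hlt
  rw [(ringKrullDim_quotient_eq_tdeg W j x).2, (ringKrullDim_quotient_eq_tdeg W j x').2] at this
  exact_mod_cast this

theorem tdeg_le_of_specializes {K : Type} [Field K] (W : Over (SpecK K))
    [LocallyOfFiniteType W.hom] {w w' : W.left} (h : w ⤳ w') :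
    tdeg W w' ≤ tdeg W w := by
  rcases eq_or_ne w w' with rfl | hne
  · rfl
  · have := tdeg_succ_le_of_specializes W h hne
    omega

theorem tdeg_le_topologicalKrullDim {K : Type} [Field K] (W : Over (SpecK K))
    [LocallyOfFiniteType W.hom] (w : W.left) :
    ((tdeg W w : ℕ) : WithBot ℕ∞) ≤ topologicalKrullDim W.left := by
  obtain ⟨A, j, _, ⟨x, rfl⟩, -⟩ :=
    Scheme.exists_affine_mem_range_and_range_subset (x := w) (U := ⊤) trivial
  rw [← (ringKrullDim_quotient_eq_tdeg W j x).2]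
  refine (ringKrullDim_quotient_le _).trans ?_
  rw [← PrimeSpectrum.topologicalKrullDim_eq_ringKrullDim]
  exact j.isOpenEmbedding.isInducing.topologicalKrullDim_le

theorem topologicalKrullDim_le_of_tdeg_le {K : Type} [Field K] (W : Over (SpecK K))
    [LocallyOfFiniteType W.hom] {Y : Type} [TopologicalSpace Y] {f : Y → W.left}
    (hf : IsInducing f) {N : ℕ} (h : ∀ w ∈ closure (Set.range f), tdeg W w ≤ N) :
    topologicalKrullDim Y ≤ N := by
  have key : ∀ Z : TopologicalSpace.IrreducibleCloseds Y,
      ∃ w : W.left, IsGenericPoint w (closure (f '' (Z : Set Y))) := fun Z =>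
    QuasiSober.sober (Z.isIrreducible.image f hf.continuous.continuousOn).closure isClosed_closure
  choose g hg using key
  have hpre : ∀ Z : TopologicalSpace.IrreducibleCloseds Y,
      (Z : Set Y) = f ⁻¹' closure (f '' (Z : Set Y)) := fun Z => by
    rw [← hf.closure_eq_preimage_closure_image, Z.isClosed.closure_eq]
  have hmono : StrictMono fun Z => tdeg W (g Z) := by
    intro Z Z' hlt
    have hsub : closure (f '' (Z : Set Y)) ⊆ closure (f '' (Z' : Set Y)) :=
      closure_mono (Set.image_mono hlt.le)
    refine Nat.lt_of_succ_le (tdeg_succ_le_of_specializes W ?_ ?_)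
    · rw [specializes_iff_mem_closure, (hg Z').def]
      exact hsub (hg Z).mem
    · intro heq
      apply hlt.ne
      apply SetLike.coe_injective
      rw [hpre Z, hpre Z', ← (hg Z).def, ← (hg Z').def, heq]
  refine iSup_le fun c => ?_
  have h1 : g c.last ∈ closure (Set.range f) :=
    closure_mono (Set.image_subset_range _ _) (hg c.last).mem
  have h2 := (c.map _ hmono).head_add_length_le_nat
  simp only [LTSeries.map_length, LTSeries.last_map] at h2
  have h3 : c.length ≤ N := by have := h _ h1; omega
  exact_mod_cast h3

theorem topologicalKrullDim_eq_tdeg_of_isGenericPoint {K : Type} [Field K] (W : Over (SpecK K))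
    [LocallyOfFiniteType W.hom] {η : W.left} (hη : IsGenericPoint η Set.univ) :
    topologicalKrullDim W.left = (tdeg W η : ℕ) :=
  le_antisymm (topologicalKrullDim_le_of_tdeg_le W IsInducing.id fun _ _ =>
    tdeg_le_of_specializes W (hη.specializes trivial)) (tdeg_le_topologicalKrullDim W η)

/-- The projections of the fibered power. -/
def powProj {K : Type} [Field K] (V : Over (SpecK K)) {Ω : Type} [Finite Ω] (ω : Ω) :
    pow K V Ω ⟶ V :=
  Pi.π (fun _ : Ω => V) ω

/-- The morphism to the fibered power with prescribed components. -/
def powLift {K : Type} [Field K] {V W : Over (SpecK K)} {Ω : Type} [Finite Ω] (f : Ω → (W ⟶ V)) :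
    W ⟶ pow K V Ω :=
  Pi.lift f

@[simp]
theorem powLift_powProj {K : Type} [Field K] {V W : Over (SpecK K)} {Ω : Type} [Finite Ω]
    (f : Ω → (W ⟶ V)) (ω : Ω) : powLift f ≫ powProj V ω = f ω :=
  Pi.lift_π f ω

theorem pow_hom_ext {K : Type} [Field K] {V W : Over (SpecK K)} {Ω : Type} [Finite Ω]
    {f g : W ⟶ pow K V Ω} (h : ∀ ω, f ≫ powProj V ω = g ≫ powProj V ω) : f = g :=
  Pi.hom_ext f g h

theorem exists_intermediateField_range_le {K L : Type} [Field K] [Field L] [Algebra K L]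
    {J : Type} [Fintype J] (E : J → Type) [∀ j, Field (E j)] [∀ j, Algebra K (E j)]
    (hE : ∀ j, Algebra.trdeg K (E j) < Cardinal.aleph0) (ρ : ∀ j, E j →ₐ[K] L) :
    ∃ F : IntermediateField K L, (∀ j y, ρ j y ∈ F) ∧ (F = ⊤ →
      Cardinal.toNat (Algebra.trdeg K L) ≤ ∑ j, Cardinal.toNat (Algebra.trdeg K (E j))) := by
  choose s hs using fun j => exists_isTranscendenceBasis K (E j)
  have hcard : ∀ j, Cardinal.mk (s j) = Algebra.trdeg K (E j) := fun j =>
    (hs j).cardinalMk_eq_trdeg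
  have hfin : ∀ j, (s j).Finite := fun j => by
    rw [← Cardinal.lt_aleph0_iff_set_finite, hcard]
    exact hE j
  let S : Set L := ⋃ j, ρ j '' s j
  have hS : S.ncard ≤ ∑ j, (s j).ncard := by
    classical
    have h : S = ↑(Finset.univ.biUnion fun j => (hfin j).toFinset.image (ρ j)) := by
      simp [S]
    rw [h, Set.ncard_coe_finset]
    refine Finset.card_biUnion_le.trans (Finset.sum_le_sum fun j _ => ?_)
    rw [Set.ncard_eq_toFinset_card _ (hfin j)]
    exact Finset.card_image_le
  have hSfin : S.Finite := Set.finite_iUnion fun j => (hfin j).image _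
  let F₀ := IntermediateField.adjoin K S
  have halg : ∀ j y, IsAlgebraic F₀ (ρ j y) := by
    intro j y
    have h1 := (hs j).isAlgebraic
    rw [Subtype.range_coe] at h1
    have h2 : ∀ x ∈ Algebra.adjoin K (s j), ρ j x ∈ F₀.toSubalgebra := by
      have : Algebra.adjoin K (s j) ≤ F₀.toSubalgebra.comap (ρ j) := by
        rw [Algebra.adjoin_le_iff]
        intro x hx
        exact IntermediateField.subset_adjoin K S (Set.mem_iUnion.2 ⟨j, x, hx, rfl⟩)
      exact this
    refine (h1.isAlgebraic y).ringHom_of_comp_eq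
      (((ρ j).comp (Algebra.adjoin K (s j)).val).codRestrict F₀.toSubalgebra fun x => h2 x x.2)
      (ρ j) ?_ rfl
    intro a b hab
    exact Subtype.ext ((ρ j).injective (congrArg Subtype.val hab))
  refine ⟨(algebraicClosure F₀ L).restrictScalars K, fun j y => ?_, fun htop => ?_⟩
  · exact mem_algebraicClosure_iff.2 (halg j y)
  · have h1 : Algebra.IsAlgebraic F₀ L := by
      refine ⟨fun x => ?_⟩
      have : x ∈ (algebraicClosure F₀ L).restrictScalars K := by rw [htop]; trivial
      exact mem_algebraicClosure_iff.1 this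
    have h2 : Algebra.IsAlgebraic (Algebra.adjoin K S) L := by
      open scoped IntermediateField.algebraAdjoinAdjoin in
      exact (IsFractionRing.comap_isAlgebraic_iff (K := F₀)).2 h1
    have h3 := Cardinal.toNat_le_toNat (Algebra.IsAlgebraic.trdeg_le_cardinalMk K S)
      (Cardinal.lt_aleph0_iff_set_finite.2 hSfin)
    refine h3.trans (hS.trans (Finset.sum_le_sum fun j _ => ?_))
    rw [← hcard]
    rfl

theorem exists_fac_fromSpecResidueField {X : Scheme.{0}} {L : Type} [Field L]
    (f : Spec (.of L) ⟶ X) {x : X} (h : f (IsLocalRing.closedPoint L) = x) :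
    ∃ e : X.residueField x ⟶ .of L, Spec.map e ≫ X.fromSpecResidueField x = f := by
  subst h
  exact ⟨_, Scheme.descResidueField_stalkClosedPointTo_fromSpecResidueField L X f⟩

/-- The map on residue fields induced by a morphism of `K`-schemes, as a `K`-algebra map. -/
def residueFieldAlgHom {K : Type} [Field K] {W W' : Over (SpecK K)} (r : W ⟶ W') (w : W.left) :
    W'.left.residueField (r.left w) →ₐ[K] W.left.residueField w :=
  { (r.left.residueFieldMap w).hom with
    commutes' := fun a => by
      have h : CommRingCat.ofHom (algebraMap K (W'.left.residueField (r.left w))) ≫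
          r.left.residueFieldMap w = CommRingCat.ofHom (algebraMap K (W.left.residueField w)) := by
        apply Spec.map_injective
        rw [Spec.map_comp, specMap_algebraMap_residueField, specMap_algebraMap_residueField,
          Scheme.Hom.SpecMap_residueFieldMap_fromSpecResidueField_assoc, Over.w]
      exact congrArg (fun g => g.hom a) h }

theorem tdeg_le_sum {K : Type} [Field K] {V : Over (SpecK K)} {Ω : Type} [Finite Ω]
    (w : (pow K V Ω).left) {J : Type} [Fintype J] (W : J → Over (SpecK K))
    [∀ j, LocallyOfFiniteType (W j).hom] (r : ∀ j, pow K V Ω ⟶ W j)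
    (hr : ∀ ω, ∃ j, ∃ s : W j ⟶ V, powProj V ω = r j ≫ s) :
    tdeg (pow K V Ω) w ≤ ∑ j, tdeg (W j) ((r j).left w) := by
  let P := pow K V Ω
  let L := P.left.residueField w
  obtain ⟨F, hF, hle⟩ := exists_intermediateField_range_le (K := K) (L := L)
    (fun j => (W j).left.residueField ((r j).left w))
    (fun j => trdeg_residueField_lt_aleph0 (W j) _) (fun j => residueFieldAlgHom (r j) w)
  refine hle ?_
  choose j s hs using hr
  let ρ : ∀ j, (W j).left.residueField ((r j).left w) ⟶ CommRingCat.of F := fun j =>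
    CommRingCat.ofHom ((residueFieldAlgHom (r j) w).codRestrict F.toSubalgebra (hF j)).toRingHom
  let i : CommRingCat.of F ⟶ L := CommRingCat.ofHom F.val.toRingHom
  have hρ : ∀ j, ρ j ≫ i = (r j).left.residueFieldMap w := fun j => rfl
  let T : Over (SpecK K) := Over.mk (Spec.map (CommRingCat.ofHom (algebraMap K F)))
  let U : Over (SpecK K) := Over.mk (Spec.map (CommRingCat.ofHom (algebraMap K L)))
  have hT : ∀ j, Spec.map (ρ j) ≫ (W j).left.fromSpecResidueField _ ≫ (W j).hom = T.hom := by
    intro j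
    rw [← specMap_algebraMap_residueField, ← Spec.map_comp]
    refine congrArg Spec.map (CommRingCat.hom_ext (RingHom.ext fun a => Subtype.ext ?_))
    exact (residueFieldAlgHom (r j) w).commutes a
  let q : ∀ j, T ⟶ W j := fun j =>
    Over.homMk (Spec.map (ρ j) ≫ (W j).left.fromSpecResidueField _) (by
      rw [Category.assoc]; exact hT j)
  let m : T ⟶ P := powLift fun ω => q (j ω) ≫ s ω
  let c : U ⟶ T := Over.homMk (Spec.map i) (by
    change Spec.map i ≫ Spec.map _ = Spec.map _
    rw [← Spec.map_comp]
    rfl)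
  let t : U ⟶ P := Over.homMk (P.left.fromSpecResidueField w)
    (specMap_algebraMap_residueField P w).symm
  have hcq : ∀ j, c ≫ q j = t ≫ r j := by
    intro j
    ext1
    change Spec.map i ≫ Spec.map (ρ j) ≫ (W j).left.fromSpecResidueField _ =
      P.left.fromSpecResidueField w ≫ (r j).left
    rw [← Spec.map_comp_assoc, hρ, Scheme.Hom.SpecMap_residueFieldMap_fromSpecResidueField]
  have hcm : c ≫ m = t := by
    refine pow_hom_ext fun ω => ?_
    rw [Category.assoc, powLift_powProj, ← Category.assoc, hcq, Category.assoc, ← hs]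
  have hcm' : Spec.map i ≫ m.left = P.left.fromSpecResidueField w := congrArg CommaMorphism.left hcm
  have hpt : m.left (IsLocalRing.closedPoint F) = w := by
    have h1 := Scheme.fromSpecResidueField_apply w (IsLocalRing.closedPoint L)
    rw [← hcm'] at h1
    have h2 : Spec.map i (IsLocalRing.closedPoint L) = IsLocalRing.closedPoint F :=
      Subsingleton.elim (α := PrimeSpectrum F) _ _
    rw [← h2]
    exact h1
  obtain ⟨e, he⟩ := exists_fac_fromSpecResidueField m.left hpt
  have hei : e ≫ i = 𝟙 L := by
    apply Spec.map_injective
    rw [← cancel_mono (P.left.fromSpecResidueField w), Spec.map_comp, Category.assoc, he, hcm']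
    simp [L]
  rw [eq_top_iff]
  intro x _
  have : i.hom (e.hom x) = x := congrArg (fun g => g.hom x) hei
  rw [← this]
  exact (e.hom x).2

theorem ev_comp {K : Type} [Field K] {W W' : Over (SpecK K)} (a : Pt K W) (f : W ⟶ W') :
    ev K (a ≫ f) = f.left (ev K a) :=
  Scheme.Hom.comp_apply a.left f.left (specPt K)

theorem specPt_eq_closedPoint (K : Type) [Field K] : specPt K = IsLocalRing.closedPoint K :=
  Subsingleton.elim (α := PrimeSpectrum K) _ _

theorem isClosed_ev {K : Type} [Field K] [IsAlgClosed K] {W : Over (SpecK K)}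
    [LocallyOfFiniteType W.hom] (a : Pt K W) : IsClosed {ev K a} := by
  have h := (pointEquivClosedPoint W.hom ⟨a.left, Over.w a⟩).2
  rw [pointEquivClosedPoint_apply_coe, ← specPt_eq_closedPoint] at h
  exact h

theorem exists_ev_eq {K : Type} [Field K] [IsAlgClosed K] {W : Over (SpecK K)}
    [LocallyOfFiniteType W.hom] {w : W.left} (hw : IsClosed {w}) : ∃ a : Pt K W, ev K a = w :=
  ⟨Over.homMk (pointOfClosedPoint W.hom w hw) (pointOfClosedPoint_comp W.hom w hw),
    pointOfClosedPoint_apply W.hom w hw _⟩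

theorem ev_injective {K : Type} [Field K] [IsAlgClosed K] {W : Over (SpecK K)}
    [LocallyOfFiniteType W.hom] : Function.Injective (ev K (W := W)) := by
  intro a b h
  ext1
  refine ext_of_apply_closedPoint_eq W.hom (Over.w a) (Over.w b) ?_
  rw [← specPt_eq_closedPoint]
  exact h

theorem exists_ev_mem {K : Type} [Field K] [IsAlgClosed K] {W : Over (SpecK K)}
    [LocallyOfFiniteType W.hom] {Z : Set W.left} (hZ : IsLocallyClosed Z) (hne : Z.Nonempty) :
    ∃ a : Pt K W, ev K a ∈ Z := by
  have : JacobsonSpace W.left := LocallyOfFiniteType.jacobsonSpace W.hom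
  obtain ⟨w, hw, hwc⟩ := nonempty_inter_closedPoints hne hZ
  obtain ⟨a, rfl⟩ := exists_ev_eq hwc
  exact ⟨a, hw⟩

/-- The constant morphism with value a given `K`-point. -/
def constPt {K : Type} [Field K] {W Y : Over (SpecK K)} (y : Pt K Y) : W ⟶ Y :=
  Over.mkIdTerminal.from W ≫ y

theorem pt_comp_constPt {K : Type} [Field K] {W Y : Over (SpecK K)} (w : Pt K W) (y : Pt K Y) :
    w ≫ constPt y = y := by
  rw [constPt, ← Category.assoc, Over.mkIdTerminal.hom_ext (w ≫ _) (𝟙 _), Category.id_comp]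

theorem exists_ev_mem_inter {K : Type} [Field K] [IsAlgClosed K] {W : Over (SpecK K)}
    [LocallyOfFiniteType W.hom] [IrreducibleSpace W.left] {U₁ U₂ : Set W.left}
    (h₁ : IsOpen U₁) (h₂ : IsOpen U₂) (hne₁ : U₁.Nonempty) (hne₂ : U₂.Nonempty) :
    ∃ a : Pt K W, ev K a ∈ U₁ ∧ ev K a ∈ U₂ :=
  exists_ev_mem (h₁.inter h₂).isLocallyClosed (nonempty_preirreducible_inter h₁ h₂ hne₁ hne₂)

theorem irreducibleSpace_of_isLimit_binaryFan {K : Type} [Field K] [IsAlgClosed K]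
    {Y Z : Over (SpecK K)} [LocallyOfFiniteType Y.hom] [LocallyOfFiniteType Z.hom]
    [IrreducibleSpace Y.left] [IrreducibleSpace Z.left] (B : BinaryFan Y Z) (hB : IsLimit B)
    [LocallyOfFiniteType B.pt.hom] : IrreducibleSpace B.pt.left := by
  let lift {W : Over (SpecK K)} (y : W ⟶ Y) (z : W ⟶ Z) : W ⟶ B.pt := hB.lift (BinaryFan.mk y z)
  have hfst {W : Over (SpecK K)} (y : W ⟶ Y) (z : W ⟶ Z) : lift y z ≫ B.fst = y :=
    hB.fac (BinaryFan.mk y z) ⟨WalkingPair.left⟩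
  have hsnd {W : Over (SpecK K)} (y : W ⟶ Y) (z : W ⟶ Z) : lift y z ≫ B.snd = z :=
    hB.fac (BinaryFan.mk y z) ⟨WalkingPair.right⟩
  have hext {W : Over (SpecK K)} {f g : W ⟶ B.pt} (h₁ : f ≫ B.fst = g ≫ B.fst)
      (h₂ : f ≫ B.snd = g ≫ B.snd) : f = g := BinaryFan.IsLimit.hom_ext hB h₁ h₂
  have hsliceY (y : Pt K Y) (z : Pt K Z) : y ≫ lift (𝟙 Y) (constPt z) = lift y z :=
    hext
      ((Category.assoc _ _ _).trans (((congrArg (y ≫ ·) (hfst _ _)).trans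
        (Category.comp_id y)).trans (hfst y z).symm))
      ((Category.assoc _ _ _).trans (((congrArg (y ≫ ·) (hsnd _ _)).trans
        (pt_comp_constPt y z)).trans (hsnd y z).symm))
  have hsliceZ (y : Pt K Y) (z : Pt K Z) : z ≫ lift (constPt y) (𝟙 Z) = lift y z :=
    hext
      ((Category.assoc _ _ _).trans (((congrArg (z ≫ ·) (hfst _ _)).trans
        (pt_comp_constPt z y)).trans (hfst y z).symm))
      ((Category.assoc _ _ _).trans (((congrArg (z ≫ ·) (hsnd _ _)).trans
        (Category.comp_id z)).trans (hsnd y z).symm))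
  have heta (a : Pt K B.pt) : lift (a ≫ B.fst) (a ≫ B.snd) = a := hext (hfst _ _) (hsnd _ _)
  have hmem : ∀ {U : Set B.pt.left} {a : Pt K B.pt}, ev K a ∈ U →
      ev K (lift (a ≫ B.fst) (a ≫ B.snd)) ∈ U := fun h => by rwa [heta]
  have hpre : PreirreducibleSpace B.pt.left := by
    refine ⟨fun U₁ U₂ h₁ h₂ hne₁ hne₂ => ?_⟩
    rw [Set.univ_inter] at hne₁ hne₂ ⊢
    obtain ⟨a₁, ha₁⟩ := exists_ev_mem h₁.isLocallyClosed hne₁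
    obtain ⟨a₂, ha₂⟩ := exists_ev_mem h₂.isLocallyClosed hne₂
    have ha₁' := hmem ha₁
    have ha₂' := hmem ha₂
    rw [← hsliceZ, ev_comp] at ha₁' ha₂'
    obtain ⟨z, hz₁, hz₂⟩ := exists_ev_mem_inter
      (h₁.preimage (lift (constPt (a₁ ≫ B.fst)) (𝟙 Z)).left.continuous)
      (h₂.preimage (lift (constPt (a₂ ≫ B.fst)) (𝟙 Z)).left.continuous) ⟨_, ha₁'⟩ ⟨_, ha₂'⟩
    rw [Set.mem_preimage, ← ev_comp, hsliceZ, ← hsliceY, ev_comp] at hz₁ hz₂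
    obtain ⟨y, hy₁, hy₂⟩ := exists_ev_mem_inter
      (h₁.preimage (lift (𝟙 Y) (constPt z)).left.continuous)
      (h₂.preimage (lift (𝟙 Y) (constPt z)).left.continuous) ⟨_, hz₁⟩ ⟨_, hz₂⟩
    exact ⟨_, hy₁, hy₂⟩
  obtain ⟨y, -⟩ := exists_ev_mem (K := K) (W := Y) isClosed_univ.isLocallyClosed Set.univ_nonempty
  obtain ⟨z, -⟩ := exists_ev_mem (K := K) (W := Z) isClosed_univ.isLocallyClosed Set.univ_nonempty
  exact { hpre with toNonempty := ⟨ev K (lift y z)⟩ }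

/-- Complete irreducible varieties. -/
def completeIrreducible (K : Type) [Field K] : ObjectProperty (Over (SpecK K)) := fun W =>
  IsProper W.hom ∧ IrreducibleSpace W.left

instance (K : Type) [Field K] :
    (completeIrreducible K).IsClosedUnderLimitsOfShape (Discrete.{0} PEmpty) where
  limitsOfShape_le := by
    rintro X ⟨p⟩
    have hX : IsTerminal X :=
      (IsLimit.equivOfNatIsoOfIso p.diag.uniqueFromEmpty _ _
        (by exact Cone.ext (Iso.refl _) (by rintro ⟨⟨⟩⟩))).1 p.isLimit
    let e : X ≅ Over.mk (𝟙 (SpecK K)) := hX.uniqueUpToIso Over.mkIdTerminal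
    have hiso : IsIso X.hom := by
      have h : e.hom.left = X.hom := (Category.comp_id _).symm.trans (Over.w e.hom)
      rw [← h]
      exact inferInstanceAs (IsIso ((Over.forget _).map e.hom))
    have hne : Nonempty X.left := ⟨(inv X.hom) (specPt K)⟩
    exact ⟨inferInstance, (Scheme.homeoOfIso (asIso X.hom)).isOpenEmbedding.irreducibleSpace⟩

instance (K : Type) [Field K] [IsAlgClosed K] :
    (completeIrreducible K).IsClosedUnderBinaryProducts where
  limitsOfShape_le := by
    rintro X ⟨p⟩
    obtain ⟨hY, hY'⟩ := p.prop_diag_obj ⟨WalkingPair.left⟩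
    obtain ⟨hZ, hZ'⟩ := p.prop_diag_obj ⟨WalkingPair.right⟩
    let B : BinaryFan (p.diag.obj ⟨WalkingPair.left⟩) (p.diag.obj ⟨WalkingPair.right⟩) :=
      BinaryFan.mk (P := X) (p.π.app ⟨WalkingPair.left⟩) (p.π.app ⟨WalkingPair.right⟩)
    have hB : IsLimit B :=
      (IsLimit.equivOfNatIsoOfIso (diagramIsoPair p.diag) _ _
        (by exact Cone.ext (Iso.refl _) (by rintro ⟨⟨⟩⟩ <;> simp [B]))).1 p.isLimit
    have hsq := Over.isPullback_of_binaryFan_isLimit B hB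
    have hX : IsProper X.hom := by
      have h : IsProper B.fst.left := MorphismProperty.of_isPullback hsq.flip hZ
      have hw : B.fst.left ≫ (p.diag.obj ⟨WalkingPair.left⟩).hom = X.hom := Over.w B.fst
      rw [← hw]
      exact MorphismProperty.comp_mem @IsProper _ _ h hY
    have hX' : LocallyOfFiniteType B.pt.hom := hX.toLocallyOfFiniteType
    exact ⟨hX, irreducibleSpace_of_isLimit_binaryFan B hB⟩

instance (K : Type) [Field K] [IsAlgClosed K] :
    (completeIrreducible K).IsClosedUnderFiniteProducts :=
  .mk'

theorem completeIrreducible_pow {K : Type} [Field K] [IsAlgClosed K] {V : Over (SpecK K)}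
    (hV : completeIrreducible K V) (Ω : Type) [Finite Ω] :
    completeIrreducible K (pow K V Ω) :=
  ObjectProperty.prop_product _ fun _ => hV

theorem isClosedMap_left {K : Type} [Field K] {W W' : Over (SpecK K)} [IsProper W.hom]
    [IsProper W'.hom] (h : W ⟶ W') : IsClosedMap h.left := by
  have hw : h.left ≫ W'.hom = W.hom := Over.w h
  have hp : IsProper (h.left ≫ W'.hom) := by rwa [hw]
  have : IsProper h.left := IsProper.of_comp _ W'.hom
  exact h.left.isClosedMap

theorem ev_mem_image_iff {K : Type} [Field K] [IsAlgClosed K] {W W' : Over (SpecK K)}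
    [LocallyOfFiniteType W.hom] [LocallyOfFiniteType W'.hom] (h : W ⟶ W') {Z : Set W.left}
    (hZ : IsClosed Z) (a : Pt K W') :
    ev K a ∈ h.left '' Z ↔ ∃ b : Pt K W, ev K b ∈ Z ∧ b ≫ h = a := by
  constructor
  · rintro ⟨w, hw, hwa⟩
    obtain ⟨b, hb, hba⟩ := exists_ev_mem (K := K)
      (hZ.inter ((isClosed_ev a).preimage h.left.continuous)).isLocallyClosed ⟨w, hw, hwa⟩
    exact ⟨b, hb, ev_injective ((ev_comp b h).trans hba)⟩
  · rintro ⟨b, hb, rfl⟩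
    exact ⟨_, hb, (ev_comp b h).symm⟩

theorem ptPow_comp_powProj {K : Type} [Field K] {V : Over (SpecK K)} {Ω : Type} [Finite Ω]
    (a : Ω → Pt K V) (ω : Ω) : ptPow K V Ω a ≫ powProj V ω = a ω :=
  powLift_powProj a ω

theorem exists_restrict_eq {K : Type} [Field K] {V : Over (SpecK K)} {G : Type} (N : Finset G)
    (b : Pt K (pow K V N)) (a₀ : Pt K V) :
    ∃ x : G → Pt K V, ptPow K V N (fun n => x n) = b := by
  classical
  refine ⟨fun g => if h : g ∈ N then b ≫ powProj V ⟨g, h⟩ else a₀, pow_hom_ext fun n => ?_⟩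
  rw [ptPow_comp_powProj]
  exact dif_pos n.2

/-- The morphism between fibered powers induced by a cellular automaton with local rule `f`. -/
def ruleMap {K : Type} [Field K] {V : Over (SpecK K)} {G : Type} [Group G] {M : Finset G}
    (f : pow K V M ⟶ V) (N Ω : Finset G) (hN : ∀ g ∈ Ω, ∀ m ∈ M, g * m ∈ N) :
    pow K V N ⟶ pow K V Ω :=
  powLift fun g => powLift (fun m : M => powProj V (⟨g * m, hN g g.2 m m.2⟩ : N)) ≫ f

theorem ptPow_comp_ruleMap {K : Type} [Field K] {V : Over (SpecK K)} {G : Type} [Group G]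
    {M : Finset G} {f : pow K V M ⟶ V} {τ : (G → Pt K V) → (G → Pt K V)}
    (hτ : ∀ x g, τ x g = ptPow K V M (fun m => x (g * m)) ≫ f) (N Ω : Finset G)
    (hN : ∀ g ∈ Ω, ∀ m ∈ M, g * m ∈ N) (x : G → Pt K V) :
    ptPow K V N (fun n => x n) ≫ ruleMap f N Ω hN = ptPow K V Ω (fun g => τ x g) := by
  refine pow_hom_ext fun g => ?_
  rw [ptPow_comp_powProj, Category.assoc, ruleMap, powLift_powProj, hτ, ← Category.assoc]
  congr 1
  refine pow_hom_ext fun m => ?_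
  rw [ptPow_comp_powProj, Category.assoc, powLift_powProj, ptPow_comp_powProj]

theorem ptPow_eq_iff {K : Type} [Field K] {V : Over (SpecK K)} {Ω : Type} [Finite Ω]
    (a b : Ω → Pt K V) : ptPow K V Ω a = ptPow K V Ω b ↔ ∀ ω, a ω = b ω := by
  refine ⟨fun h ω => ?_, fun h => congrArg _ (funext h)⟩
  rw [← ptPow_comp_powProj a, h, ptPow_comp_powProj]

theorem exists_isClosed_ev_mem_iff {K : Type} [Field K] [IsAlgClosed K] {V : Over (SpecK K)}
    (hV : completeIrreducible K V) {G : Type} [Group G] {M : Finset G} {f : pow K V M ⟶ V}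
    {τ : (G → Pt K V) → (G → Pt K V)}
    (hτ : ∀ x g, τ x g = ptPow K V M (fun m => x (g * m)) ≫ f) (c : G → Pt K V) (g : G)
    (Ω : Finset G) (E : Finset (G × Pt K V)) :
    ∃ C : Set V.left, IsClosed C ∧ ∀ a : Pt K V, ev K a ∈ C ↔
      ∃ x, (∀ h ∈ Ω, τ x h = c h) ∧ (∀ p ∈ E, x p.1 = p.2) ∧ x g = a := by
  classical
  have hproper : ∀ N : Finset G, IsProper (pow K V N).hom := fun N =>
    (completeIrreducible_pow hV N).1
  have := hV.1
  have hirr := hV.2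
  obtain ⟨a₀, -⟩ := exists_ev_mem (K := K) (W := V) isClosed_univ.isLocallyClosed
    Set.univ_nonempty
  let N : Finset G := insert g (E.image Prod.fst ∪ Finset.image₂ (· * ·) Ω M)
  have hg : g ∈ N := Finset.mem_insert_self _ _
  have hE : ∀ p ∈ E, p.1 ∈ N := fun p hp => Finset.mem_insert_of_mem
    (Finset.mem_union_left _ (Finset.mem_image_of_mem _ hp))
  have hN : ∀ g ∈ Ω, ∀ m ∈ M, g * m ∈ N := fun h hh m hm => Finset.mem_insert_of_mem
    (Finset.mem_union_right _ (Finset.mem_image₂_of_mem hh hm))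
  let Z : Set (pow K V N).left :=
    (ruleMap f N Ω hN).left ⁻¹' {ev K (ptPow K V Ω fun h => c h)} ∩
      ⋂ p : E, (powProj V (⟨p.1.1, hE p p.2⟩ : N)).left ⁻¹' {ev K p.1.2}
  have hZ : IsClosed Z := ((isClosed_ev _).preimage (Scheme.Hom.continuous _)).inter
    (isClosed_iInter fun p => (isClosed_ev _).preimage (Scheme.Hom.continuous _))
  have hmem : ∀ x : G → Pt K V, ev K (ptPow K V N fun n => x n) ∈ Z ↔
      (∀ h ∈ Ω, τ x h = c h) ∧ ∀ p ∈ E, x p.1 = p.2 := by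
    intro x
    simp only [Z, Set.mem_inter_iff, Set.mem_preimage, Set.mem_iInter, Set.mem_singleton_iff,
      ← ev_comp, ev_injective.eq_iff, ptPow_comp_ruleMap hτ, ptPow_comp_powProj, ptPow_eq_iff,
      Subtype.forall]
  refine ⟨(powProj V (⟨g, hg⟩ : N)).left '' Z, isClosedMap_left _ _ hZ, fun a => ?_⟩
  rw [ev_mem_image_iff _ hZ]
  constructor
  · rintro ⟨b, hb, rfl⟩
    obtain ⟨x, rfl⟩ := exists_restrict_eq N b a₀
    exact ⟨x, ((hmem x).1 hb).1, ((hmem x).1 hb).2,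
      (ptPow_comp_powProj (fun n : N => x n) ⟨g, hg⟩).symm⟩
  · rintro ⟨x, h₁, h₂, rfl⟩
    exact ⟨_, (hmem x).2 ⟨h₁, h₂⟩, ptPow_comp_powProj _ _⟩

/-- The image of an algebraic cellular automaton over a complete variety is closed in the
prodiscrete topology. -/
theorem mem_range_of_forall_finset {K : Type} [Field K] [IsAlgClosed K] {V : Over (SpecK K)}
    (hV : completeIrreducible K V) {G : Type} [Group G] {M : Finset G} {f : pow K V M ⟶ V}
    {τ : (G → Pt K V) → (G → Pt K V)}
    (hτ : ∀ x g, τ x g = ptPow K V M (fun m => x (g * m)) ≫ f) (c : G → Pt K V)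
    (hc : ∀ Ω : Finset G, ∃ x, ∀ h ∈ Ω, τ x h = c h) : c ∈ Set.range τ := by
  classical
  have hpr := hV.1
  have hirr := hV.2
  have hcpt : CompactSpace V.left := compactSpace_of_universallyClosed V.hom
  let P : Set (G × Pt K V) → Prop := fun R => ∀ (E : Finset (G × Pt K V)), ↑E ⊆ R →
    ∀ Ω : Finset G, ∃ x, (∀ h ∈ Ω, τ x h = c h) ∧ ∀ p ∈ E, x p.1 = p.2
  have hP : Order.IsOfFiniteCharacter {R | P R} := by
    intro R
    refine ⟨fun hR S hS _ E hE => hR E (hE.trans hS), fun h E hE => ?_⟩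
    exact h E hE E.finite_toSet E subset_rfl
  obtain ⟨R, -, hR⟩ := hP.exists_maximal (x := ∅) fun E hE Ω => by
    obtain ⟨x, hx⟩ := hc Ω
    exact ⟨x, hx, fun p hp => (hE hp).elim⟩
  have hRP : P R := hR.prop
  have hdom : ∀ g : G, ∃ a, (g, a) ∈ R := by
    intro g
    choose C hC hCmem using exists_isClosed_ev_mem_iff hV hτ c g
    have hne : (⋂ i : Finset G × {E : Finset (G × Pt K V) // ↑E ⊆ R}, C i.1 i.2.1).Nonempty := by
      refine CompactSpace.iInter_nonempty (fun i => hC _ _) fun u => ?_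
      obtain ⟨x, hx, hxE⟩ := hRP (u.biUnion fun i => i.2.1)
        (by simpa using fun i j hj _ => hj) (u.biUnion fun i => i.1)
      refine ⟨ev K (x g), Set.mem_iInter₂.2 fun i hi => (hCmem _ _ _).2 ⟨x, ?_, ?_, rfl⟩⟩
      · exact fun h hh => hx h (Finset.mem_biUnion.2 ⟨i, hi, hh⟩)
      · exact fun p hp => hxE p (Finset.mem_biUnion.2 ⟨i, hi, hp⟩)
    obtain ⟨a, ha⟩ := exists_ev_mem (K := K) (isClosed_iInter fun i => hC _ _).isLocallyClosed hne
    rw [Set.mem_iInter] at ha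
    refine ⟨a, hR.mem_of_prop_insert (x := (g, a)) fun E hE Ω => ?_⟩
    obtain ⟨x, hx, hxE, hxg⟩ := (hCmem _ _ _).1 (ha ⟨Ω, E.erase (g, a), fun p hp => by
      have h := Finset.mem_erase.1 hp
      exact (hE h.2).resolve_left h.1⟩)
    refine ⟨x, hx, fun p hp => ?_⟩
    by_cases hpg : p = (g, a)
    · rw [hpg, hxg]
    · exact hxE p (Finset.mem_erase.2 ⟨hpg, hp⟩)
  choose x hx using hdom
  refine ⟨x, funext fun h => ?_⟩
  obtain ⟨y, hy, hyE⟩ := hRP (M.image fun m => (h * m, x (h * m)))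
    (by
      intro p hp
      obtain ⟨m, -, rfl⟩ := Finset.mem_image.1 hp
      exact hx _) {h}
  rw [← hy h (Finset.mem_singleton_self h), hτ, hτ]
  congr 2
  funext m
  exact (hyE _ (Finset.mem_image_of_mem _ m.2)).symm

theorem exists_isClosed_ne_univ_of_not_surjective {K : Type} [Field K] [IsAlgClosed K]
    {V : Over (SpecK K)} (hV : completeIrreducible K V) {G : Type} [Group G] {M : Finset G}
    {f : pow K V M ⟶ V} {τ : (G → Pt K V) → (G → Pt K V)}
    (hτ : ∀ x g, τ x g = ptPow K V M (fun m => x (g * m)) ≫ f)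
    (hsurj : ¬ Function.Surjective τ) :
    ∃ (Ω : Finset G) (C : Set (pow K V Ω).left), Ω.Nonempty ∧ IsClosed C ∧ C ≠ Set.univ ∧
      ∀ x t, ev K (ptPow K V Ω fun ω => τ x (t * ω)) ∈ C := by
  classical
  have hproper : ∀ N : Finset G, IsProper (pow K V N).hom := fun N =>
    (completeIrreducible_pow hV N).1
  have hpr := hV.1
  obtain ⟨c, hc⟩ := not_forall.1 hsurj
  obtain ⟨Ω, hΩ⟩ := not_forall.1 fun h => hc (mem_range_of_forall_finset hV hτ c h)
  have hN : ∀ g ∈ Ω, ∀ m ∈ M, g * m ∈ Finset.image₂ (· * ·) Ω M := fun h hh m hm =>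
    Finset.mem_image₂_of_mem hh hm
  let φ := ruleMap f _ Ω hN
  refine ⟨Ω, φ.left '' Set.univ, ?_, isClosedMap_left φ _ isClosed_univ, fun h => ?_,
    fun x t => ?_⟩
  · rw [Finset.nonempty_iff_ne_empty]
    rintro rfl
    exact hΩ ⟨c, by simp⟩
  · have hmem : ev K (ptPow K V Ω fun ω => c ω) ∈ φ.left '' Set.univ := h ▸ Set.mem_univ _
    obtain ⟨b, -, hb⟩ := (ev_mem_image_iff φ isClosed_univ _).1 hmem
    obtain ⟨x, rfl⟩ := exists_restrict_eq _ b (c 1)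
    rw [ptPow_comp_ruleMap hτ, ptPow_eq_iff] at hb
    exact hΩ ⟨x, fun h hh => hb ⟨h, hh⟩⟩
  · have hshift : (fun ω : Ω => τ x (t * ω)) = fun ω : Ω => τ (fun g => x (t * g)) ω := by
      funext ω
      simp only [hτ, mul_assoc]
    rw [hshift, ← ptPow_comp_ruleMap hτ _ Ω hN]
    exact (ev_mem_image_iff φ isClosed_univ _).2 ⟨_, Set.mem_univ _, rfl⟩

theorem tdeg_le_of_isGenericPoint {K : Type} [Field K] {V : Over (SpecK K)}
    [LocallyOfFiniteType V.hom] {η : V.left} (hη : IsGenericPoint η Set.univ) (v : V.left) :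
    tdeg V v ≤ tdeg V η :=
  tdeg_le_of_specializes V (hη.specializes (Set.mem_univ v))

theorem tdeg_pow_le {K : Type} [Field K] {V : Over (SpecK K)} [LocallyOfFiniteType V.hom]
    {η : V.left} (hη : IsGenericPoint η Set.univ) {Ω : Type} [Fintype Ω] (w : (pow K V Ω).left) :
    tdeg (pow K V Ω) w ≤ Fintype.card Ω * tdeg V η := by
  refine (tdeg_le_sum w (fun _ : Ω => V) (fun ω => powProj V ω)
    fun ω => ⟨ω, 𝟙 V, (Category.comp_id _).symm⟩).trans ?_
  refine (Finset.sum_le_card_nsmul _ _ _ fun ω _ => tdeg_le_of_isGenericPoint hη _).trans ?_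
  rw [Finset.card_univ, smul_eq_mul]

theorem tdeg_pow_succ_le {K : Type} [Field K] [IsAlgClosed K] {V : Over (SpecK K)}
    (hV : completeIrreducible K V) {η : V.left} (hη : IsGenericPoint η Set.univ) {Ω : Type}
    [Fintype Ω] {C : Set (pow K V Ω).left} (hC : IsClosed C) (hne : C ≠ Set.univ)
    {w : (pow K V Ω).left} (hw : w ∈ C) :
    tdeg (pow K V Ω) w + 1 ≤ Fintype.card Ω * tdeg V η := by
  have hpr := hV.1
  obtain ⟨hpr', hirr⟩ := completeIrreducible_pow hV Ω
  have hξ := genericPoint_spec (pow K V Ω).left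
  refine (tdeg_succ_le_of_specializes _ (hξ.specializes (Set.mem_univ w)) ?_).trans
    (tdeg_pow_le hη _)
  rintro rfl
  exact hne (Set.eq_univ_of_univ_subset ((hξ.mem_closed_set_iff hC).1 hw))

/-- The projection of a fibered power to the factors indexed by a left translate. -/
def translateProj {K : Type} [Field K] (V : Over (SpecK K)) {G : Type} [Group G] {Ω F : Finset G}
    (t : G) (ht : ∀ ω ∈ Ω, t * ω ∈ F) : pow K V F ⟶ pow K V Ω :=
  powLift fun ω => powProj V (⟨t * ω, ht ω ω.2⟩ : F)

theorem tdeg_add_card_le {K : Type} [Field K] [IsAlgClosed K] {V : Over (SpecK K)}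
    (hV : completeIrreducible K V) {η : V.left} (hη : IsGenericPoint η Set.univ) {G : Type}
    [Group G] {Ω F T : Finset G} {C : Set (pow K V Ω).left} (hC : IsClosed C)
    (hne : C ≠ Set.univ) (hT : ∀ t ∈ T, ∀ ω ∈ Ω, t * ω ∈ F)
    (hdisj : ∀ t ∈ T, ∀ t' ∈ T, ∀ ω ∈ Ω, ∀ ω' ∈ Ω, t * ω = t' * ω' → t = t')
    {w : (pow K V F).left} (hw : ∀ t (ht : t ∈ T), (translateProj V t (hT t ht)).left w ∈ C) :
    tdeg (pow K V F) w + T.card ≤ F.card * tdeg V η := by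
  classical
  have hpr := hV.1
  have hpr' := (completeIrreducible_pow hV Ω).1
  let U : Finset G := (T ×ˢ Ω).image fun p => p.1 * p.2
  have hU : U.card = T.card * Ω.card := by
    rw [← Finset.card_product]
    refine Finset.card_image_of_injOn ?_
    rintro ⟨t, ω⟩ hp ⟨t', ω'⟩ hp' h
    obtain ⟨ht, hω⟩ := Finset.mem_product.1 (Finset.mem_coe.1 hp)
    obtain ⟨ht', hω'⟩ := Finset.mem_product.1 (Finset.mem_coe.1 hp')
    obtain rfl : t = t' := hdisj t ht t' ht' ω hω ω' hω' h
    exact Prod.ext rfl (mul_left_cancel h)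
  have hUF : U ⊆ F := by
    intro g hg
    obtain ⟨⟨t, ω⟩, hp, rfl⟩ := Finset.mem_image.1 hg
    obtain ⟨ht, hω⟩ := Finset.mem_product.1 hp
    exact hT t ht ω hω
  let W : T ⊕ ↥(F \ U) → Over (SpecK K) := Sum.elim (fun _ => pow K V Ω) fun _ => V
  let r : ∀ j, pow K V F ⟶ W j
    | .inl t => translateProj V t (hT t t.2)
    | .inr g => powProj V (⟨g, (Finset.mem_sdiff.1 g.2).1⟩ : F)
  have hW : ∀ j, LocallyOfFiniteType (W j).hom := by
    rintro (t | g)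
    · exact hpr'.toLocallyOfFiniteType
    · exact hpr.toLocallyOfFiniteType
  have hsum := tdeg_le_sum w W r (by
    rintro ⟨g, hg⟩
    by_cases hgU : g ∈ U
    · obtain ⟨⟨t, ω⟩, hp, rfl⟩ := Finset.mem_image.1 hgU
      obtain ⟨ht, hω⟩ := Finset.mem_product.1 hp
      exact ⟨.inl ⟨t, ht⟩, powProj V (⟨ω, hω⟩ : Ω),
        (powLift_powProj (fun ω : Ω => powProj V (⟨t * ω, hT t ht ω ω.2⟩ : F)) ⟨ω, hω⟩).symm⟩
    · exact ⟨.inr ⟨g, Finset.mem_sdiff.2 ⟨hg, hgU⟩⟩, 𝟙 V, (Category.comp_id _).symm⟩)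
  rw [Fintype.sum_sum_type] at hsum
  have h₁ : ∑ t : T, tdeg (W (.inl t)) ((r (.inl t)).left w) + T.card ≤
      T.card * (Ω.card * tdeg V η) := by
    have h : ∑ t : T, (tdeg (W (.inl t)) ((r (.inl t)).left w) + 1) ≤
        ∑ t : T, Ω.card * tdeg V η := Finset.sum_le_sum fun t _ => by
      have := tdeg_pow_succ_le hV hη hC hne (hw t t.2)
      rwa [Fintype.card_coe] at this
    rw [Finset.sum_add_distrib] at h
    simpa using h
  have h₂ : ∑ g : ↥(F \ U), tdeg (W (.inr g)) ((r (.inr g)).left w) ≤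
      (F \ U).card * tdeg V η := by
    have h : ∑ g : ↥(F \ U), tdeg (W (.inr g)) ((r (.inr g)).left w) ≤
        ∑ g : ↥(F \ U), tdeg V η :=
      Finset.sum_le_sum fun g _ => tdeg_le_of_isGenericPoint hη _
    simpa using h
  have hcard : (F \ U).card + T.card * Ω.card = F.card := by
    rw [← hU, Finset.card_sdiff_add_card_eq_card hUF]
  calc tdeg (pow K V F) w + T.card
      ≤ T.card * (Ω.card * tdeg V η) + (F \ U).card * tdeg V η := by omega
    _ = F.card * tdeg V η := by rw [← hcard]; ring

theorem cfgDim_le {K : Type} [Field K] [IsAlgClosed K] {V : Over (SpecK K)}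
    (hV : completeIrreducible K V) {η : V.left} (hη : IsGenericPoint η Set.univ) {G : Type}
    [Group G] {Ω F T : Finset G} {C : Set (pow K V Ω).left} (hC : IsClosed C)
    (hne : C ≠ Set.univ) (hT : ∀ t ∈ T, ∀ ω ∈ Ω, t * ω ∈ F)
    (hdisj : ∀ t ∈ T, ∀ t' ∈ T, ∀ ω ∈ Ω, ∀ ω' ∈ Ω, t * ω = t' * ω' → t = t')
    {Γ : Set (G → Pt K V)} (hΓ : Γ.Nonempty)
    (hΓC : ∀ x ∈ Γ, ∀ t, ev K (ptPow K V Ω fun ω => x (t * ω)) ∈ C) :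
    ∃ N : ℕ, N + T.card ≤ F.card * tdeg V η ∧ cfgDim K V F (restr K V Γ F) ≤ N := by
  have hpr := (completeIrreducible_pow hV F).1
  let := cfgTop K V F
  let φ : restr K V Γ F → (pow K V F).left := fun u => ev K (ptPow K V F u.1)
  have hφ : IsInducing φ :=
    IsInducing.comp (g := fun u => ev K (ptPow K V F u)) ⟨rfl⟩ IsInducing.subtypeVal
  have hcl : ∀ w ∈ closure (Set.range φ), tdeg (pow K V F) w + T.card ≤ F.card * tdeg V η := by
    refine fun w hw => tdeg_add_card_le hV hη hC hne hT hdisj fun t ht => ?_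
    refine closure_minimal (t := (translateProj V t (hT t ht)).left ⁻¹' C) ?_
      (hC.preimage (Scheme.Hom.continuous _)) hw
    rintro _ ⟨⟨_, x, hx, rfl⟩, rfl⟩
    change (translateProj V t (hT t ht)).left (ev K (ptPow K V F fun g => x g)) ∈ C
    rw [← ev_comp]
    convert hΓC x hx t using 2
    refine pow_hom_ext fun ω => ?_
    rw [Category.assoc, translateProj, powLift_powProj, ptPow_comp_powProj, ptPow_comp_powProj]
  obtain ⟨x, hx⟩ := hΓ
  have hle := hcl _ (subset_closure ⟨⟨_, x, hx, rfl⟩, rfl⟩)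
  exact ⟨F.card * tdeg V η - T.card, by omega,
    topologicalKrullDim_le_of_tdeg_le _ hφ fun w hw => by have := hcl w hw; omega⟩

theorem exists_disjoint_translates {G : Type} [Group G] {Ω : Finset G} (hΩ : Ω.Nonempty)
    (S : Finset G) : ∃ T ⊆ S,
      (∀ t ∈ T, ∀ t' ∈ T, ∀ ω ∈ Ω, ∀ ω' ∈ Ω, t * ω = t' * ω' → t = t') ∧
      S.card ≤ T.card * Ω.card ^ 2 := by
  classical
  let P : Finset G → Prop := fun T =>
    T ⊆ S ∧ ∀ t ∈ T, ∀ t' ∈ T, ∀ ω ∈ Ω, ∀ ω' ∈ Ω, t * ω = t' * ω' → t = t'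
  obtain ⟨T, hT, hmax⟩ := (S.powerset.filter P).exists_max_image Finset.card
    ⟨∅, by simp [P]⟩
  obtain ⟨hTS, hdisj⟩ : P T := (Finset.mem_filter.1 hT).2
  refine ⟨T, hTS, hdisj, ?_⟩
  have hcover : S ⊆ (T ×ˢ (Ω ×ˢ Ω)).image fun p => p.1 * p.2.1 * p.2.2⁻¹ := by
    intro s hs
    by_contra hcon
    have hfar : ∀ t ∈ T, ∀ ω ∈ Ω, ∀ ω' ∈ Ω, s * ω ≠ t * ω' := by
      intro t ht ω hω ω' hω' h
      refine hcon (Finset.mem_image.2 ⟨(t, ω', ω), by simp [ht, hω, hω'], ?_⟩)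
      simp [← h]
    have hsT : s ∉ T := fun h => by
      obtain ⟨ω, hω⟩ := hΩ
      exact hfar s h ω hω ω hω rfl
    have hP : P (insert s T) := by
      refine ⟨Finset.insert_subset hs hTS, fun t ht t' ht' ω hω ω' hω' h => ?_⟩
      rcases Finset.mem_insert.1 ht with rfl | htT <;>
        rcases Finset.mem_insert.1 ht' with rfl | htT'
      · rfl
      · exact (hfar t' htT' ω hω ω' hω' h).elim
      · exact (hfar t htT ω' hω' ω hω h.symm).elim
      · exact hdisj t htT t' htT' ω hω ω' hω' h
    have := hmax _ (Finset.mem_filter.2 ⟨Finset.mem_powerset.2 hP.1, hP⟩)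
    rw [Finset.card_insert_of_notMem hsT] at this
    omega
  refine (Finset.card_le_card hcover).trans (Finset.card_image_le.trans ?_)
  simp [Finset.card_product, sq]

theorem FolnerNet.eventually_card_le {G : Type} [Group G] (𝓕 : FolnerNet G) (Ω : Finset G) :
    ∀ᶠ i in atTop, ∃ S ⊆ 𝓕.F i, (∀ t ∈ S, ∀ ω ∈ Ω, t * ω ∈ 𝓕.F i) ∧
      (𝓕.F i).card ≤ 2 * S.card := by
  classical
  have hlim := tendsto_finsetSum Ω fun ω _ => 𝓕.folner ω⁻¹
  rw [Finset.sum_const_zero] at hlim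
  filter_upwards [hlim.eventually_le_const (show (0 : ℝ) < 1 / 2 by norm_num)] with i hi
  let F := 𝓕.F i
  have hF : (0 : ℝ) < F.card := by exact_mod_cast (𝓕.nonempty i).card_pos
  refine ⟨F.filter fun t => ∀ ω ∈ Ω, t * ω ∈ F, Finset.filter_subset _ _,
    fun t ht => (Finset.mem_filter.1 ht).2, ?_⟩
  have hle : (F.filter fun t => ¬ ∀ ω ∈ Ω, t * ω ∈ F).card ≤
      ∑ ω ∈ Ω, ((F : Set G) \ ((· * ω⁻¹) '' (F : Set G))).ncard := by
    have hsub : (F.filter fun t => ¬ ∀ ω ∈ Ω, t * ω ∈ F) ⊆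
        Ω.biUnion fun ω => F \ F.image (· * ω⁻¹) := by
      intro t ht
      obtain ⟨htF, ht⟩ := Finset.mem_filter.1 ht
      push Not at ht
      obtain ⟨ω, hω, htω⟩ := ht
      refine Finset.mem_biUnion.2 ⟨ω, hω, Finset.mem_sdiff.2 ⟨htF, fun h => ?_⟩⟩
      obtain ⟨g, hg, rfl⟩ := Finset.mem_image.1 h
      exact htω (by simpa using hg)
    refine (Finset.card_le_card hsub).trans (Finset.card_biUnion_le.trans_eq ?_)
    refine Finset.sum_congr rfl fun ω _ => ?_
    rw [← Set.ncard_coe_finset, Finset.coe_sdiff, Finset.coe_image]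
  have hsum : (∑ ω ∈ Ω, (((F : Set G) \ ((· * ω⁻¹) '' (F : Set G))).ncard : ℝ)) ≤
      1 / 2 * F.card := by
    rwa [← div_le_iff₀ hF, Finset.sum_div]
  have hsplit := Finset.card_filter_add_card_filter_not (s := F) fun t => ∀ ω ∈ Ω, t * ω ∈ F
  have hle' : ((F.filter fun t => ¬ ∀ ω ∈ Ω, t * ω ∈ F).card : ℝ) ≤ 1 / 2 * F.card :=
    le_trans (by exact_mod_cast hle) hsum
  have hsplit' : ((F.filter fun t => ∀ ω ∈ Ω, t * ω ∈ F).card : ℝ) +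
      (F.filter fun t => ¬ ∀ ω ∈ Ω, t * ω ∈ F).card = F.card := by exact_mod_cast hsplit
  have : (F.card : ℝ) ≤ 2 * (F.filter fun t => ∀ ω ∈ Ω, t * ω ∈ F).card := by linarith
  exact_mod_cast this

theorem dimE_natCast (n : ℕ) : dimE (n : WithBot ℕ∞) = ((n : ℝ) : EReal) := by
  change (((n : ℕ∞) : ℝ≥0∞) : EReal) = _
  rw [ENat.toENNReal_coe]
  rfl

theorem dimE_le_of_le_natCast {x : WithBot ℕ∞} {n : ℕ} (h : x ≤ n) :
    dimE x ≤ ((n : ℝ) : EReal) := by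
  induction x with
  | bot => exact bot_le
  | coe m =>
    rw [← dimE_natCast]
    have hm : m ≤ (n : ℕ∞) := WithBot.coe_le_coe.1 h
    exact EReal.coe_ennreal_le_coe_ennreal_iff.2 (ENat.toENNReal_le.2 hm)

/-- The mean dimension of the image of a non-surjective algebraic cellular automaton is not
maximal. -/
theorem mdim_range_lt_of_not_surjective {K : Type} [Field K] [IsAlgClosed K]
    {V : Over (SpecK K)} (hV : completeIrreducible K V) {G : Type} [Group G] (𝓕 : FolnerNet G)
    {τ : (G → Pt K V) → (G → Pt K V)} (hca : IsAlgCA K V τ) (hsurj : ¬ Function.Surjective τ) :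
    mdim K V 𝓕 (Set.range τ) < dimE (vdim K V) := by
  have hpr := hV.1
  have hirr := hV.2
  have hη := genericPoint_spec V.left
  obtain ⟨M, f, hτ⟩ := hca
  obtain ⟨Ω, C, hΩ, hC, hne, hmem⟩ := exists_isClosed_ne_univ_of_not_surjective hV hτ hsurj
  obtain ⟨c, -⟩ := not_forall.1 hsurj
  set d := tdeg V (genericPoint V.left)
  have hdim : dimE (vdim K V) = ((d : ℝ) : EReal) := by
    rw [vdim, topologicalKrullDim_eq_tdeg_of_isGenericPoint V hη]
    exact dimE_natCast d
  have hΩ' : (0 : ℝ) < Ω.card := by exact_mod_cast hΩ.card_pos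
  have hε : (0 : ℝ) < 1 / (2 * (Ω.card : ℝ) ^ 2) := by positivity
  rw [hdim]
  refine lt_of_le_of_lt (b := ((d - 1 / (2 * (Ω.card : ℝ) ^ 2) : ℝ) : EReal)) ?_
    (EReal.coe_lt_coe (by linarith))
  refine limsup_le_of_le (by isBoundedDefault) ?_
  filter_upwards [𝓕.eventually_card_le Ω] with i ⟨S, hSF, hS, hcard⟩
  have hF : (0 : ℝ) < (𝓕.F i).card := by exact_mod_cast (𝓕.nonempty i).card_pos
  obtain ⟨T, hTS, hdisj, hT⟩ := exists_disjoint_translates hΩ S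
  obtain ⟨N, hN, hle⟩ := cfgDim_le hV hη (F := 𝓕.F i) hC hne (fun t ht => hS t (hTS ht)) hdisj
    (Γ := Set.range τ) ⟨_, c, rfl⟩ (by rintro _ ⟨x, rfl⟩ t; exact hmem x t)
  refine (mul_le_mul_of_nonneg_right (dimE_le_of_le_natCast hle)
    (EReal.coe_nonneg.2 (by positivity))).trans ?_
  rw [← EReal.coe_mul, EReal.coe_le_coe_iff, ← div_eq_mul_inv, div_le_iff₀ hF]
  have h₁ : (N : ℝ) + T.card ≤ (𝓕.F i).card * d := by exact_mod_cast hN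
  have h₂ : ((𝓕.F i).card : ℝ) ≤ 2 * (T.card * (Ω.card : ℝ) ^ 2) := by
    exact_mod_cast hcard.trans (Nat.mul_le_mul_left 2 hT)
  have h₃ : 1 / (2 * (Ω.card : ℝ) ^ 2) * (𝓕.F i).card ≤ T.card := by
    rw [one_div_mul_eq_div, div_le_iff₀ (by positivity)]
    linarith
  linarith

/-- Theorem 5.4. Let `G` be an amenable group with a Følner net `𝓕`,
`X` an irreducible complete algebraic variety over an algebraically closed field `K`,
`A := X(K)`, and `τ` an algebraic cellular automaton over `(G,X,K)`. If
`mdim_𝓕(τ(A^G)) = dim X` then `τ` is surjective. -/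
theorem surjective_of_maximal_mdim
    (G : Type) [Group G] (𝓕 : FolnerNet G)
    (K : Type) [Field K] [IsAlgClosed K]
    (V : Over (SpecK K)) (hft : LocallyOfFiniteType V.hom) (hqc : QuasiCompact V.hom)
    (hirr : IrreducibleSpace V.left) (hcomplete : IsProper V.hom)
    (τ : (G → Pt K V) → (G → Pt K V)) (hca : IsAlgCA K V τ)
    (hmdim : mdim K V 𝓕 (Set.range τ) = dimE (vdim K V)) :
    Function.Surjective τ := by
  by_contra hsurj
  exact (mdim_range_lt_of_not_surjective ⟨hcomplete, hirr⟩ 𝓕 hca hsurj).ne hmdim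

end GOE
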